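/- arXiv:2104.03442 — 5 statements merged into one kernel-verified Lean document; each statement's English description precedes it below -/
import Mathlib

section
/- For every integer n ≥ 3, the map which sends a pair (τ, μ), where τ is a permutation of [n] and μ ⊆ [n] has even cardinality, to the permutation s_τ ∘ t_μ of E(n), is injective, and its image is exactly the group G_n. In particular G_n has order n! · 2^{n−1}. -/
open Finset
open scoped symmDiff

/-- `SpinorIndex n` is the set `E(n)` of subsets `λ ⊆ [n]` such that `n - |λ|` is even. -/
def SpinorIndex (n : ℕ) : Type := {l : Finset (Fin n) // Even (n - l.card)}

theorem card_symmDiff_decomp {n : ℕ} (μ l : Finset (Fin n)) :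
    (μ ∆ l).card = (μ \ l).card + (l \ μ).card := by
  rw [symmDiff_def]
  exact Finset.card_union_of_disjoint disjoint_sdiff_sdiff

theorem even_sub_card_symmDiff {n : ℕ} {μ l : Finset (Fin n)} (hμ : Even μ.card)
    (hl : Even (n - l.card)) : Even (n - (μ ∆ l).card) := by
  have h3 := card_symmDiff_decomp μ l
  have h4 := Finset.card_sdiff_add_card_inter μ l
  have h5 := Finset.card_sdiff_add_card_inter l μ
  have h6 : (μ ∩ l).card = (l ∩ μ).card := by rw [Finset.inter_comm]
  have h7 : l.card ≤ n := by simpa using Finset.card_le_univ l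
  have h8 : (μ ∆ l).card ≤ n := by simpa using Finset.card_le_univ (μ ∆ l)
  rw [Nat.even_sub h7] at hl
  rw [Nat.even_sub h8]
  simp only [Nat.even_iff] at hμ hl ⊢
  omega

/-- The permutation `t_μ : E(n) → E(n)`, `λ ↦ μ ∆ λ`, for `μ ⊆ [n]` of even cardinality. -/
def tPerm (n : ℕ) (μ : Finset (Fin n)) (hμ : Even μ.card) : Equiv.Perm (SpinorIndex n) where
  toFun l := ⟨μ ∆ l.1, even_sub_card_symmDiff hμ l.2⟩
  invFun l := ⟨μ ∆ l.1, even_sub_card_symmDiff hμ l.2⟩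
  left_inv l := Subtype.ext (symmDiff_symmDiff_cancel_left μ l.1)
  right_inv l := Subtype.ext (symmDiff_symmDiff_cancel_left μ l.1)

/-- The permutation `s_τ : E(n) → E(n)`, `λ ↦ τ(λ)`, for a permutation `τ` of `[n]`. -/
def sPerm (n : ℕ) (τ : Equiv.Perm (Fin n)) : Equiv.Perm (SpinorIndex n) where
  toFun l := ⟨l.1.image τ, by
    rw [Finset.card_image_of_injective _ τ.injective]; exact l.2⟩
  invFun l := ⟨l.1.image τ.symm, by
    rw [Finset.card_image_of_injective _ τ.symm.injective]; exact l.2⟩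
  left_inv l := Subtype.ext (by
    simp [Finset.image_image])
  right_inv l := Subtype.ext (by
    simp [Finset.image_image])

/-- `H_n = { t_μ : μ ⊆ [n], |μ| even }` as a set of permutations of `E(n)`. -/
def Hset (n : ℕ) : Set (Equiv.Perm (SpinorIndex n)) :=
  {σ | ∃ (μ : Finset (Fin n)) (hμ : Even μ.card), σ = tPerm n μ hμ}

/-- `G_n` is the subgroup of the symmetric group on `E(n)` generated by all `s_τ` and all
`t_μ`. -/
def Gn (n : ℕ) : Subgroup (Equiv.Perm (SpinorIndex n)) :=
  Subgroup.closure ({σ | ∃ τ : Equiv.Perm (Fin n), σ = sPerm n τ} ∪ Hset n)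


/-- The map `(τ, μ) ↦ s_τ ∘ t_μ`. -/
noncomputable def stMap (n : ℕ) :
    Equiv.Perm (Fin n) × {μ : Finset (Fin n) // Even μ.card} →
      Equiv.Perm (SpinorIndex n) :=
  fun p => sPerm n p.1 * tPerm n p.2.1 p.2.2

theorem sPerm_val {n : ℕ} (τ : Equiv.Perm (Fin n)) (l : SpinorIndex n) :
    (sPerm n τ l).1 = l.1.image τ := rfl

theorem tPerm_val {n : ℕ} (μ : Finset (Fin n)) (hμ : Even μ.card) (l : SpinorIndex n) :
    (tPerm n μ hμ l).1 = μ ∆ l.1 := rfl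

theorem stMap_val {n : ℕ} (p : Equiv.Perm (Fin n) × {μ : Finset (Fin n) // Even μ.card})
    (l : SpinorIndex n) :
    (stMap n p l).1 = p.2.1.image p.1 ∆ l.1.image p.1 :=
  Finset.image_symmDiff p.2.1 l.1 p.1.injective

theorem even_card_image_perm {n : ℕ} (τ : Equiv.Perm (Fin n)) {μ : Finset (Fin n)}
    (hμ : Even μ.card) : Even (μ.image τ).card := by
  rwa [Finset.card_image_of_injective _ τ.injective]

theorem even_card_symmDiff {n : ℕ} {μ ν : Finset (Fin n)} (hμ : Even μ.card)
    (hν : Even ν.card) : Even (μ ∆ ν).card := by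
  have h3 := card_symmDiff_decomp μ ν
  have h4 := Finset.card_sdiff_add_card_inter μ ν
  have h5 := Finset.card_sdiff_add_card_inter ν μ
  have h6 : (μ ∩ ν).card = (ν ∩ μ).card := by rw [Finset.inter_comm]
  simp only [Nat.even_iff] at hμ hν ⊢
  omega

theorem SpinorIndex.ext {n : ℕ} {l m : SpinorIndex n} (h : l.1 = m.1) : l = m :=
  Subtype.ext h

theorem perm_eq_of_image_pair_eq {n : ℕ} (hn : 3 ≤ n) {σ τ : Equiv.Perm (Fin n)}
    (h : ∀ a b, a ≠ b → ({a, b} : Finset (Fin n)).image σ = ({a, b} : Finset (Fin n)).image τ) :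
    σ = τ := by
  ext1 a
  obtain ⟨b, hb⟩ : ∃ b, b ∉ ({a} : Finset (Fin n)) := by
    by_contra! hall
    have := Finset.card_le_card (fun x _ => hall x : (Finset.univ : Finset (Fin n)) ⊆ {a})
    simp at this
    omega
  obtain ⟨c, hc⟩ : ∃ c, c ∉ ({a, b} : Finset (Fin n)) := by
    by_contra! hall
    have h1 := Finset.card_le_card (fun x _ => hall x : (Finset.univ : Finset (Fin n)) ⊆ {a, b})
    have h2 := Finset.card_le_two (a := a) (b := b)
    simp only [Finset.card_univ, Fintype.card_fin] at h1
    omega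
  simp only [Finset.mem_insert, Finset.mem_singleton, not_or] at hb hc
  have h1 : σ a ∈ ({a, b} : Finset (Fin n)).image τ := by
    rw [← h a b (Ne.symm hb)]; simp
  have h2 : σ a ∈ ({a, c} : Finset (Fin n)).image τ := by
    rw [← h a c (Ne.symm hc.1)]; simp
  simp only [Finset.image_insert, Finset.image_singleton, Finset.mem_insert,
    Finset.mem_singleton] at h1 h2
  rcases h1 with h1 | h1
  · exact h1
  · rcases h2 with h2 | h2
    · exact h2
    · exact absurd (τ.injective (h2.symm.trans h1)) hc.2

theorem stMap_injective {n : ℕ} (hn : 3 ≤ n) : Function.Injective (stMap n) := by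
  rintro p q hpq
  have key : ∀ l : Finset (Fin n), Even (n - l.card) →
      p.2.1.image p.1 ∆ l.image p.1 = q.2.1.image q.1 ∆ l.image q.1 := by
    intro l hl
    have := congrArg (fun f : Equiv.Perm (SpinorIndex n) => (f ⟨l, hl⟩).1) hpq
    exact (stMap_val p ⟨l, hl⟩).symm.trans (this.trans (stMap_val q ⟨l, hl⟩))
  have hμ : p.2.1.image p.1 = q.2.1.image q.1 := by
    have := key Finset.univ (by simp)
    rw [Finset.image_univ_equiv, Finset.image_univ_equiv] at this
    exact symmDiff_left_injective _ this
  have hτ : p.1 = q.1 := by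
    refine perm_eq_of_image_pair_eq hn fun a b hab => ?_
    have h2 : ({a, b} : Finset (Fin n)).card = 2 := Finset.card_pair hab
    have := key ({a, b} : Finset (Fin n))ᶜ (by
      rw [Finset.card_compl, Fintype.card_fin, h2, Nat.sub_sub_self (by omega)]
      exact even_two)
    rw [hμ] at this
    have := symmDiff_right_injective _ this
    have hcompl : ∀ σ : Equiv.Perm (Fin n),
        ({a, b} : Finset (Fin n))ᶜ.image σ = (({a, b} : Finset (Fin n)).image σ)ᶜ := fun σ =>
      Finset.coe_injective <| by
        simpa only [Finset.coe_image, Finset.coe_compl] using Set.image_compl_eq σ.bijective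
    rw [hcompl, hcompl] at this
    exact compl_injective this
  refine Prod.ext hτ (Subtype.ext ?_)
  rw [hτ] at hμ
  exact Finset.image_injective q.1.injective hμ

theorem stMap_mul {n : ℕ} (p q : Equiv.Perm (Fin n) × {μ : Finset (Fin n) // Even μ.card}) :
    stMap n p * stMap n q = stMap n (p.1 * q.1,
      ⟨p.2.1.image q.1.symm ∆ q.2.1,
        even_card_symmDiff (even_card_image_perm q.1.symm p.2.2) q.2.2⟩) := by
  refine Equiv.ext fun l => SpinorIndex.ext ?_
  rw [Equiv.Perm.mul_apply, stMap_val, stMap_val, stMap_val,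
    Finset.image_symmDiff _ _ p.1.injective,
    Finset.image_symmDiff _ _ (p.1 * q.1).injective, symmDiff_assoc]
  simp [Finset.image_image, Function.comp_def]

theorem stMap_one {n : ℕ} : stMap n (1, ⟨∅, by simp⟩) = 1 := by
  refine Equiv.ext fun l => SpinorIndex.ext ?_
  rw [stMap_val]
  simp [← Finset.bot_eq_empty]

theorem stMap_inv {n : ℕ} (p : Equiv.Perm (Fin n) × {μ : Finset (Fin n) // Even μ.card}) :
    (stMap n p)⁻¹ = stMap n (p.1⁻¹, ⟨p.2.1.image p.1, even_card_image_perm p.1 p.2.2⟩) := by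
  rw [inv_eq_iff_mul_eq_one, stMap_mul, ← stMap_one]
  congr 1
  refine Prod.ext (mul_inv_cancel _) (Subtype.ext ?_)
  change p.2.1.image p.1 ∆ p.2.1.image p.1 = ∅
  exact symmDiff_self _

theorem range_stMap (n : ℕ) :
    Set.range (stMap n) = (Gn n : Set (Equiv.Perm (SpinorIndex n))) := by
  apply Set.Subset.antisymm
  · rintro _ ⟨p, rfl⟩
    exact mul_mem (Subgroup.subset_closure (Or.inl ⟨p.1, rfl⟩))
      (Subgroup.subset_closure (Or.inr ⟨p.2.1, p.2.2, rfl⟩))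
  · intro σ hσ
    induction hσ using Subgroup.closure_induction with
    | mem σ h =>
      rcases h with ⟨τ, rfl⟩ | ⟨μ, hμ, rfl⟩
      · refine ⟨(τ, ⟨∅, by simp⟩), Equiv.ext fun l => SpinorIndex.ext ?_⟩
        rw [stMap_val, sPerm_val, Finset.image_empty]
        exact bot_symmDiff _
      · refine ⟨(1, ⟨μ, hμ⟩), Equiv.ext fun l => SpinorIndex.ext ?_⟩
        rw [stMap_val, tPerm_val]
        simp
    | one => exact ⟨_, stMap_one⟩
    | mul x y _ _ hx hy =>
      obtain ⟨p, rfl⟩ := hx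
      obtain ⟨q, rfl⟩ := hy
      exact ⟨_, (stMap_mul p q).symm⟩
    | inv x _ hx =>
      obtain ⟨p, rfl⟩ := hx
      exact ⟨_, (stMap_inv p).symm⟩

theorem two_mul_card_even_subsets {n : ℕ} (hn : n ≠ 0) :
    2 * Nat.card {μ : Finset (Fin n) // Even μ.card} = 2 ^ n := by
  have : NeZero n := ⟨hn⟩
  have hflip : ∀ μ : Finset (Fin n), Even (({0} : Finset (Fin n)) ∆ μ).card ↔ ¬ Even μ.card := by
    intro μ
    have h3 := card_symmDiff_decomp {0} μ
    have h4 := Finset.card_sdiff_add_card_inter {0} μ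
    have h5 := Finset.card_sdiff_add_card_inter μ {0}
    have h6 : ({0} ∩ μ).card = (μ ∩ {0}).card := by rw [Finset.inter_comm]
    rw [Finset.card_singleton] at h4
    simp only [Nat.even_iff]
    omega
  have e : {μ : Finset (Fin n) // Even μ.card} ≃ {μ : Finset (Fin n) // ¬ Even μ.card} :=
    (Function.Involutive.toPerm (fun μ => ({0} : Finset (Fin n)) ∆ μ)
      (symmDiff_symmDiff_cancel_left _)).subtypeEquiv fun μ =>
        iff_not_comm.mp (hflip μ)
  have h := Nat.card_congr (Equiv.sumCompl fun μ : Finset (Fin n) => Even μ.card)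
  rw [Nat.card_sum, ← Nat.card_congr e, Nat.card_eq_fintype_card (α := Finset (Fin n)),
    Fintype.card_finset, Fintype.card_fin] at h
  omega

theorem spinor_Gn_structure (n : ℕ) (hn : 3 ≤ n) :
    Function.Injective (stMap n) ∧
    Set.range (stMap n) = (Gn n : Set (Equiv.Perm (SpinorIndex n))) ∧
    Nat.card (Gn n) = n.factorial * 2 ^ (n - 1) := by
  refine ⟨stMap_injective hn, range_stMap n, ?_⟩
  have h1 : Nat.card (Gn n) = Nat.card (Set.range (stMap n)) := by
    rw [range_stMap]; rfl
  have h2 := two_mul_card_even_subsets (n := n) (by omega)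
  obtain ⟨m, rfl⟩ : ∃ m, n = m + 1 := ⟨n - 1, by omega⟩
  rw [pow_succ] at h2
  rw [h1, Nat.card_range_of_injective (stMap_injective hn), Nat.card_prod, Nat.card_perm,
    Nat.card_fin, Nat.add_sub_cancel]
  congr 1
  omega
end

section
/- Let n ≥ 1, let B be a nonempty collection of subsets of [n], let u : [n] → ℝ, and let B_u = { λ ∈ B : Σ_{k∈λ} u(k) ≤ Σ_{k∈λ'} u(k) for all λ' ∈ B }. Let μ, ν ⊆ [n] and suppose there exists i₀ ∈ ν∖μ with μ∪{i₀} ∈ B_u and ν∖{i₀} ∈ B_u. Then: (a) for every i ∈ ν∖μ, if μ∪{i} ∈ B and ν∖{i} ∈ B then μ∪{i} ∈ B_u and ν∖{i} ∈ B_u; and (b) for every j ∈ μ∖ν, if μ∖{j} ∈ B and ν∪{j} ∈ B then μ∖{j} ∈ B_u and ν∪{j} ∈ B_u. -/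
open Finset

/-- `B_u`: the members of `B` minimizing the linear functional `λ ↦ Σ_{k∈λ} u(k)`. -/
def minimizers {n : ℕ} (B : Set (Finset (Fin n))) (u : Fin n → ℝ) : Set (Finset (Fin n)) :=
  {l ∈ B | ∀ l' ∈ B, ∑ k ∈ l, u k ≤ ∑ k ∈ l', u k}

theorem mem_minimizers_of_sum_add_sum_eq {n : ℕ} {B : Set (Finset (Fin n))} {u : Fin n → ℝ}
    {a b c d : Finset (Fin n)} (ha : a ∈ minimizers B u) (hb : b ∈ minimizers B u)
    (hc : c ∈ B) (hd : d ∈ B)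
    (h : ∑ k ∈ c, u k + ∑ k ∈ d, u k = ∑ k ∈ a, u k + ∑ k ∈ b, u k) :
    c ∈ minimizers B u ∧ d ∈ minimizers B u := by
  have hac := ha.2 c hc
  have hbd := hb.2 d hd
  refine ⟨⟨hc, fun l hl => ?_⟩, hd, fun l hl => ?_⟩
  · linarith [ha.2 l hl]
  · linarith [hb.2 l hl]

theorem sum_insert_add_sum_erase {α M : Type*} [DecidableEq α] [AddCommMonoid M] {s t : Finset α}
    {i : α} (hs : i ∉ s) (ht : i ∈ t) (u : α → M) :
    ∑ k ∈ insert i s, u k + ∑ k ∈ t.erase i, u k = ∑ k ∈ s, u k + ∑ k ∈ t, u k := by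
  rw [sum_insert hs, ← add_sum_erase t u ht]
  abel

theorem face_bases_exchange {n : ℕ} (hn : 1 ≤ n) (B : Set (Finset (Fin n)))
    (hB : B.Nonempty) (u : Fin n → ℝ) (μ ν : Finset (Fin n)) (i₀ : Fin n)
    (hi₀ : i₀ ∈ ν \ μ) (h₁ : insert i₀ μ ∈ minimizers B u)
    (h₂ : ν.erase i₀ ∈ minimizers B u) :
    (∀ i ∈ ν \ μ, insert i μ ∈ B → ν.erase i ∈ B →
      insert i μ ∈ minimizers B u ∧ ν.erase i ∈ minimizers B u) ∧
    (∀ j ∈ μ \ ν, μ.erase j ∈ B → insert j ν ∈ B →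
      μ.erase j ∈ minimizers B u ∧ insert j ν ∈ minimizers B u) := by
  rw [mem_sdiff] at hi₀
  have h₀ := sum_insert_add_sum_erase hi₀.2 hi₀.1 u
  refine ⟨fun i hi hc hd => ?_, fun j hj hc hd => ?_⟩
  · rw [mem_sdiff] at hi
    exact mem_minimizers_of_sum_add_sum_eq h₁ h₂ hc hd
      ((sum_insert_add_sum_erase hi.2 hi.1 u).trans h₀.symm)
  · rw [mem_sdiff] at hj
    refine mem_minimizers_of_sum_add_sum_eq h₁ h₂ hc hd ?_
    rw [add_comm, sum_insert_add_sum_erase hj.2 hj.1 u, add_comm, h₀]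
end

section
/- Let k be a field, n ≥ 1, B a nonempty collection of subsets of [n], w : (subsets of [n]) → ℝ, u : [n] → ℝ, and let B_u^w = { λ ∈ B : w(λ) + Σ_{k∈λ} u(k) ≤ w(λ') + Σ_{k∈λ'} u(k) for all λ' ∈ B }. For all subsets μ, ν ⊆ [n] with |μ Δ ν| ≥ 4, either P_{B_u^w}(μ,ν) = 0, or P_{B_u^w}(μ,ν) equals the w-initial form of P_B(μ,ν), i.e., the sum of exactly those terms c · q_η q_λ of P_B(μ,ν) for which w(η) + w(λ) is minimal among all terms of P_B(μ,ν). -/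
open Finset MvPolynomial
open scoped symmDiff Classical

/-- The exponent `ℓ(i; μ, ν) = #{ j ∈ ν : i < j } + #{ j ∈ μ : i > j }` governing the sign
`(−1)^{sgn(i;μ,ν)}`. -/
def sgnExp {n : ℕ} (i : Fin n) (μ ν : Finset (Fin n)) : ℕ :=
  (ν.filter fun j => i < j).card + (μ.filter fun j => j < i).card

/-- The quadric `P_B(μ,ν)` associated to a collection `B` of subsets of `[n]`. -/
noncomputable def PB (k : Type*) [Field k] {n : ℕ} (B : Set (Finset (Fin n)))
    (μ ν : Finset (Fin n)) : MvPolynomial (Finset (Fin n)) k :=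
  (∑ i ∈ (ν \ μ).filter (fun i => insert i μ ∈ B ∧ ν.erase i ∈ B),
      (-1 : MvPolynomial (Finset (Fin n)) k) ^ sgnExp i μ ν *
        X (insert i μ) * X (ν.erase i)) +
  ∑ j ∈ (μ \ ν).filter (fun j => μ.erase j ∈ B ∧ insert j ν ∈ B),
      (-1 : MvPolynomial (Finset (Fin n)) k) ^ sgnExp j ν μ *
        X (μ.erase j) * X (insert j ν)

/-- The `w`-weight of a monomial `∏ q_λ^{a_λ}`, namely `Σ a_λ · w(λ)`. -/
noncomputable def monWeight {σ : Type*} (w : σ → ℝ) (d : σ →₀ ℕ) : ℝ :=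
  d.sum fun l a => (a : ℝ) * w l

/-- The `w`-initial form of a polynomial: the sum of its terms of minimal `w`-weight. -/
noncomputable def initialForm {σ : Type*} {k : Type*} [Field k] (w : σ → ℝ)
    (f : MvPolynomial σ k) : MvPolynomial σ k :=
  ∑ d ∈ f.support.filter (fun d => ∀ e ∈ f.support, monWeight w d ≤ monWeight w e),
    monomial d (f.coeff d)

/-- `B_u^w`: the members of `B` minimizing `λ ↦ w(λ) + Σ_{k∈λ} u(k)`. -/
def wMinimizers {n : ℕ} (B : Set (Finset (Fin n))) (w : Finset (Fin n) → ℝ)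
    (u : Fin n → ℝ) : Set (Finset (Fin n)) :=
  {l ∈ B | ∀ l' ∈ B, w l + ∑ k ∈ l, u k ≤ w l' + ∑ k ∈ l', u k}

/-- The exponent of `q_{μ ∆ {i}} q_{ν ∆ {i}}`. -/
noncomputable def exchangeExponent {n : ℕ} (μ ν : Finset (Fin n)) (i : Fin n) :
    Finset (Fin n) →₀ ℕ :=
  Finsupp.single (μ ∆ {i}) 1 + Finsupp.single (ν ∆ {i}) 1

/-- The sign with which the exchange of `i` between `μ` and `ν` enters `P_B(μ,ν)`. -/
noncomputable def exchangeSign (k : Type*) [Field k] {n : ℕ} (μ ν : Finset (Fin n))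
    (i : Fin n) : k :=
  if i ∈ ν then (-1) ^ sgnExp i μ ν else (-1) ^ sgnExp i ν μ

/-- The indices contributing to `P_B(μ,ν)`. -/
noncomputable def exchangeIndices {n : ℕ} (B : Set (Finset (Fin n))) (μ ν : Finset (Fin n)) :
    Finset (Fin n) :=
  (μ ∆ ν).filter fun i => μ ∆ {i} ∈ B ∧ ν ∆ {i} ∈ B

lemma symmDiff_singleton_of_notMem {α : Type*} [DecidableEq α] {s : Finset α} {a : α}
    (h : a ∉ s) : s ∆ {a} = insert a s := by
  ext x
  by_cases hx : x = a <;> simp_all [mem_symmDiff]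

lemma symmDiff_singleton_of_mem {α : Type*} [DecidableEq α] {s : Finset α} {a : α}
    (h : a ∈ s) : s ∆ {a} = s.erase a := by
  ext x
  by_cases hx : x = a <;> simp_all [mem_symmDiff]

lemma exchangeSign_ne_zero (k : Type*) [Field k] {n : ℕ} (μ ν : Finset (Fin n)) (i : Fin n) :
    exchangeSign k μ ν i ≠ 0 := by
  unfold exchangeSign
  split_ifs <;> simp

lemma monomial_single_add_single {σ k : Type*} [Field k] (a b : σ) (m : ℕ) :
    monomial (Finsupp.single a 1 + Finsupp.single b 1) ((-1 : k) ^ m) =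
      (-1 : MvPolynomial σ k) ^ m * X a * X b := by
  rw [X, X, mul_assoc, monomial_mul, one_mul, show (-1 : MvPolynomial σ k) ^ m = C ((-1) ^ m) by
    simp, C_mul_monomial, mul_one]

lemma PB_eq_sum_monomial (k : Type*) [Field k] {n : ℕ} (B : Set (Finset (Fin n)))
    (μ ν : Finset (Fin n)) :
    PB k B μ ν = ∑ i ∈ exchangeIndices B μ ν,
      monomial (exchangeExponent μ ν i) (exchangeSign k μ ν i) := by
  have hdisj : Disjoint (ν \ μ) (μ \ ν) := disjoint_sdiff_sdiff
  rw [exchangeIndices, symmDiff_comm μ ν, symmDiff_def, sup_eq_union, filter_union,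
    sum_union (disjoint_filter_filter hdisj), PB]
  congr 1
  · refine sum_congr (filter_congr fun i hi => ?_) fun i hi => ?_
    · rw [mem_sdiff] at hi
      rw [symmDiff_singleton_of_notMem hi.2, symmDiff_singleton_of_mem hi.1]
    · obtain ⟨h, h'⟩ := mem_sdiff.1 (mem_filter.1 hi).1
      rw [exchangeExponent, exchangeSign, if_pos h, symmDiff_singleton_of_notMem h',
        symmDiff_singleton_of_mem h, monomial_single_add_single]
  · refine sum_congr (filter_congr fun i hi => ?_) fun i hi => ?_
    · rw [mem_sdiff] at hi
      rw [symmDiff_singleton_of_notMem hi.2, symmDiff_singleton_of_mem hi.1]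
    · obtain ⟨h, h'⟩ := mem_sdiff.1 (mem_filter.1 hi).1
      rw [exchangeExponent, exchangeSign, if_neg h', symmDiff_singleton_of_notMem h',
        symmDiff_singleton_of_mem h, monomial_single_add_single]

/-- Distinct exchanges give distinct monomials as soon as `μ` and `ν` differ in more than two
places. -/
lemma exchangeExponent_injective {n : ℕ} {μ ν : Finset (Fin n)} (h : 2 < (μ ∆ ν).card) :
    Function.Injective (exchangeExponent μ ν) := by
  intro i j hij
  have hmem : exchangeExponent μ ν j (μ ∆ {i}) ≠ 0 := by
    rw [← hij]
    simp [exchangeExponent]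
  have hcases : μ ∆ {j} = μ ∆ {i} ∨ ν ∆ {j} = μ ∆ {i} := by
    by_contra! hne
    simp [exchangeExponent, hne.1, hne.2] at hmem
  rcases hcases with h' | h'
  · exact (singleton_injective (symmDiff_right_injective μ h')).symm
  · have hμν : μ ∆ ν = {i} ∆ {j} := by
      rw [← symmDiff_symmDiff_cancel_right {j} ν, h', symmDiff_assoc, symmDiff_symmDiff_cancel_left]
    have hcard : (μ ∆ ν).card ≤ 2 := by
      rw [hμν]
      exact (card_le_card symmDiff_le_sup).trans (card_union_le _ _)
    omega

lemma monWeight_exchangeExponent {n : ℕ} (w : Finset (Fin n) → ℝ) (μ ν : Finset (Fin n))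
    (i : Fin n) : monWeight w (exchangeExponent μ ν i) = w (μ ∆ {i}) + w (ν ∆ {i}) := by
  rw [monWeight, exchangeExponent, Finsupp.sum_add_index']
  · simp
  · simp
  · intros
    push_cast
    ring

lemma sum_add_sum_exchange {n : ℕ} (u : Fin n → ℝ) {μ ν : Finset (Fin n)} {i : Fin n}
    (hi : i ∈ μ ∆ ν) :
    ∑ k ∈ μ ∆ {i}, u k + ∑ k ∈ ν ∆ {i}, u k = ∑ k ∈ μ, u k + ∑ k ∈ ν, u k := by
  rcases mem_symmDiff.1 hi with ⟨h, h'⟩ | ⟨h, h'⟩ <;>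
  · rw [symmDiff_singleton_of_notMem h', symmDiff_singleton_of_mem h, sum_insert h',
      ← add_sum_erase _ _ h]
    ring

lemma coeff_sum_monomial_of_injective {ι σ k : Type*} [Field k] (S : Finset ι)
    {e : ι → σ →₀ ℕ} (he : Function.Injective e) (c : ι → k) {i : ι} (hi : i ∈ S) :
    coeff (e i) (∑ j ∈ S, monomial (e j) (c j)) = c i := by
  simp [coeff_sum, coeff_monomial, he.eq_iff, hi]

lemma support_sum_monomial_of_injective {ι σ k : Type*} [Field k] (S : Finset ι)
    {e : ι → σ →₀ ℕ} (he : Function.Injective e) {c : ι → k} (hc : ∀ i, c i ≠ 0) :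
    (∑ j ∈ S, monomial (e j) (c j)).support = S.map ⟨e, he⟩ := by
  ext d
  rw [mem_support_iff, mem_map]
  constructor
  · intro hd
    rw [coeff_sum] at hd
    obtain ⟨i, hi, hid⟩ := exists_ne_zero_of_sum_ne_zero hd
    rw [coeff_monomial] at hid
    exact ⟨i, hi, (ite_ne_right_iff.1 hid).1⟩
  · rintro ⟨i, hi, rfl⟩
    exact (coeff_sum_monomial_of_injective S he c hi).trans_ne (hc i)

lemma initialForm_sum_monomial_of_injective {ι σ k : Type*} [Field k] (w : σ → ℝ) (S : Finset ι)
    {e : ι → σ →₀ ℕ} (he : Function.Injective e) {c : ι → k} (hc : ∀ i, c i ≠ 0) :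
    initialForm w (∑ j ∈ S, monomial (e j) (c j)) =
      ∑ i ∈ S.filter (fun i => ∀ j ∈ S, monWeight w (e i) ≤ monWeight w (e j)),
        monomial (e i) (c i) := by
  rw [initialForm, support_sum_monomial_of_injective S he hc, filter_map, sum_map]
  refine sum_congr (filter_congr fun i _ => by simp) fun i hi => ?_
  rw [Function.Embedding.coeFn_mk, coeff_sum_monomial_of_injective S he c (mem_filter.1 hi).1]

lemma mem_exchangeIndices {n : ℕ} {B : Set (Finset (Fin n))} {μ ν : Finset (Fin n)} {i : Fin n} :
    i ∈ exchangeIndices B μ ν ↔ i ∈ μ ∆ ν ∧ μ ∆ {i} ∈ B ∧ ν ∆ {i} ∈ B :=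
  mem_filter

/-- If one exchange lands in `B_u^w`, the exchanges landing in `B_u^w` are those of minimal
weight. -/
lemma exchangeIndices_wMinimizers {n : ℕ} {B : Set (Finset (Fin n))} {w : Finset (Fin n) → ℝ}
    {u : Fin n → ℝ} {μ ν : Finset (Fin n)}
    (h : (exchangeIndices (wMinimizers B w u) μ ν).Nonempty) :
    exchangeIndices (wMinimizers B w u) μ ν =
      (exchangeIndices B μ ν).filter fun i => ∀ j ∈ exchangeIndices B μ ν,
        monWeight w (exchangeExponent μ ν i) ≤ monWeight w (exchangeExponent μ ν j) := by
  obtain ⟨i₀, hi₀⟩ := h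
  simp only [mem_exchangeIndices, wMinimizers, Set.mem_ofPred_eq] at hi₀
  obtain ⟨hs₀, ⟨hμ₀, hμmin₀⟩, hν₀, hνmin₀⟩ := hi₀
  have hsum₀ := sum_add_sum_exchange u hs₀
  ext i
  simp only [mem_filter, mem_exchangeIndices, wMinimizers, Set.mem_ofPred_eq,
    monWeight_exchangeExponent]
  constructor
  · rintro ⟨hs, ⟨hμ, hμmin⟩, hν, hνmin⟩
    refine ⟨⟨hs, hμ, hν⟩, fun j ⟨hsj, hμj, hνj⟩ => ?_⟩
    linarith [hμmin _ hμj, hνmin _ hνj, sum_add_sum_exchange u hs, sum_add_sum_exchange u hsj]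
  · rintro ⟨⟨hs, hμ, hν⟩, hmin⟩
    have hle := hmin i₀ ⟨hs₀, hμ₀, hν₀⟩
    have hsum := sum_add_sum_exchange u hs
    refine ⟨hs, ⟨hμ, fun l hl => ?_⟩, hν, fun l hl => ?_⟩
    · linarith [hμmin₀ l hl, hνmin₀ _ hν]
    · linarith [hνmin₀ l hl, hμmin₀ _ hμ]

theorem PB_wMinimizers_eq_zero_or_initialForm (k : Type*) [Field k] {n : ℕ} (hn : 1 ≤ n)
    (B : Set (Finset (Fin n))) (hB : B.Nonempty) (w : Finset (Fin n) → ℝ) (u : Fin n → ℝ)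
    (μ ν : Finset (Fin n)) (hμν : 4 ≤ (μ ∆ ν).card) :
    PB k (wMinimizers B w u) μ ν = 0 ∨
      PB k (wMinimizers B w u) μ ν = initialForm w (PB k B μ ν) := by
  rcases (exchangeIndices (wMinimizers B w u) μ ν).eq_empty_or_nonempty with h | h
  · left
    rw [PB_eq_sum_monomial, h, sum_empty]
  · right
    rw [PB_eq_sum_monomial, PB_eq_sum_monomial,
      initialForm_sum_monomial_of_injective w _ (exchangeExponent_injective (by omega))
        (exchangeSign_ne_zero k μ ν), exchangeIndices_wMinimizers h]
    congr!
end

section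
/- Let k be a field of characteristic 0, n ≥ 1, and let A, B be n × n matrices over k satisfying A·Bᵀ + B·Aᵀ = 0 (i.e., the row span of the n × 2n block matrix [A|B] is totally isotropic for the standard hyperbolic quadratic form). For a subset S ⊆ [n], let M_S be the n × n matrix whose j-th column is the j-th column of A if j ∈ S and the j-th column of B if j ∉ S. If S, T ⊆ [n] satisfy det(M_S) ≠ 0 and det(M_T) ≠ 0, then |S Δ T| is even. (Equivalently: the Δ-matroid of a totally isotropic subspace is even.) -/
open Finset Matrix
open scoped symmDiff

/-- `M_S`: the `n × n` matrix whose `j`-th column is the `j`-th column of `A` if `j ∈ S`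
and the `j`-th column of `B` if `j ∉ S`. -/
def colMix {k : Type*} [Field k] {n : ℕ} (A B : Matrix (Fin n) (Fin n) k)
    (S : Finset (Fin n)) : Matrix (Fin n) (Fin n) k :=
  fun i j => if j ∈ S then A i j else B i j

/-- For a skew-symmetric matrix `W` and a set `D` of columns, replacing the columns of the identity
indexed by `D` with those of `W` gives a matrix whose determinant is fixed by `(-1) ^ |D|`. -/
theorem det_one_add_sub_one_mul_diagonal_of_skew {R ι : Type*} [CommRing R] [Fintype ι]
    [DecidableEq ι] {W : Matrix ι ι R} (hW : Wᵀ = -W) (D : Finset ι) :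
    (1 + (W - 1) * diagonal (fun j => if j ∈ D then (1 : R) else 0)).det =
      (-1) ^ D.card * (1 + (W - 1) * diagonal (fun j => if j ∈ D then (1 : R) else 0)).det := by
  set E : Matrix ι ι R := diagonal (fun j => if j ∈ D then (1 : R) else 0) with hE
  have hEE : E * E = E := by
    simp [hE, diagonal_mul_diagonal, ← ite_and]
  have hET : Eᵀ = E := diagonal_transpose _
  have htr : (1 + (W - 1) * E)ᵀ = (1 - (E + E)) * (1 + E * (W - 1)) := by
    have h2 : E * (E * (W - 1)) = E * (W - 1) := by rw [← Matrix.mul_assoc, hEE]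
    have h3 : (1 - (E + E)) * (1 + E * (W - 1)) = 1 - (E + E) - E * (W - 1) := by
      rw [sub_mul, one_mul, add_mul, mul_add, h2, mul_one]
      abel
    rw [h3, transpose_add, transpose_mul, transpose_sub, hW, hET, transpose_one, mul_sub, mul_sub,
      mul_neg, mul_one]
    abel
  have hdet : (1 - (E + E)).det = (-1) ^ D.card := by
    have : 1 - (E + E) = diagonal (fun j => if j ∈ D then (-1 : R) else 1) := by
      ext i j
      by_cases hij : i = j
      · subst hij
        by_cases hi : i ∈ D <;> simp [hE, hi]
      · simp [hE, hij]
    rw [this, det_diagonal, Finset.prod_ite_mem, Finset.univ_inter, Finset.prod_const]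
  calc (1 + (W - 1) * E).det = (1 + (W - 1) * E)ᵀ.det := (det_transpose _).symm
    _ = (-1) ^ D.card * (1 + (W - 1) * E).det := by
      rw [htr, det_mul, hdet, det_one_add_mul_comm]

/-- Exchanging columns of `A` and `B` preserves isotropy. -/
theorem colMix_isotropic {k : Type*} [Field k] {n : ℕ} {A B : Matrix (Fin n) (Fin n) k}
    (hiso : A * Bᵀ + B * Aᵀ = 0) (S : Finset (Fin n)) :
    colMix A B S * (colMix B A S)ᵀ + colMix B A S * (colMix A B S)ᵀ = 0 := by
  rw [← hiso]
  ext i j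
  simp only [Matrix.add_apply, mul_apply, transpose_apply, ← Finset.sum_add_distrib, colMix]
  refine Finset.sum_congr rfl fun l _ => ?_
  split_ifs
  · rfl
  · exact add_comm _ _

theorem colMix_eq_add_sub_mul_diagonal {k : Type*} [Field k] {n : ℕ}
    (A B : Matrix (Fin n) (Fin n) k) (S T : Finset (Fin n)) :
    colMix A B T = colMix A B S + (colMix B A S - colMix A B S) *
      diagonal (fun j => if j ∈ S ∆ T then (1 : k) else 0) := by
  ext i j
  by_cases hS : j ∈ S <;> by_cases hT : j ∈ T <;>
    simp [colMix, mul_diagonal, Finset.mem_symmDiff, hS, hT]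

theorem deltaMatroid_of_isotropic_is_even {k : Type*} [Field k] [CharZero k] {n : ℕ}
    (hn : 1 ≤ n) (A B : Matrix (Fin n) (Fin n) k)
    (hiso : A * Bᵀ + B * Aᵀ = 0) (S T : Finset (Fin n))
    (hS : (colMix A B S).det ≠ 0) (hT : (colMix A B T).det ≠ 0) :
    Even ((S ∆ T).card) := by
  have hu : IsUnit (colMix A B S).det := isUnit_iff_ne_zero.mpr hS
  set P := colMix A B S with hP
  set Q := colMix B A S with hQ
  have hPQ : P * Qᵀ = -(Q * Pᵀ) := eq_neg_of_add_eq_zero_left (colMix_isotropic hiso S)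
  have huT : IsUnit Pᵀ.det := by rwa [det_transpose]
  have hW : (P⁻¹ * Q)ᵀ = -(P⁻¹ * Q) := by
    calc (P⁻¹ * Q)ᵀ = P⁻¹ * (P * Qᵀ) * Pᵀ⁻¹ := by
          rw [nonsing_inv_mul_cancel_left _ _ hu, transpose_mul, transpose_nonsing_inv]
      _ = -(P⁻¹ * Q) := by
          rw [hPQ, mul_neg, neg_mul, ← Matrix.mul_assoc, mul_nonsing_inv_cancel_right _ _ huT]
  have hfac : colMix A B T = P * (1 + (P⁻¹ * Q - 1) *
      diagonal (fun j => if j ∈ S ∆ T then (1 : k) else 0)) := by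
    rw [colMix_eq_add_sub_mul_diagonal A B S T, ← hP, ← hQ, mul_add, ← Matrix.mul_assoc, mul_sub,
      mul_nonsing_inv_cancel_left _ _ hu, mul_one]
  rw [hfac, det_mul] at hT
  have hN := right_ne_zero_of_mul hT
  have hdet := det_one_add_sub_one_mul_diagonal_of_skew hW (S ∆ T)
  by_contra hodd
  rw [(Nat.not_even_iff_odd.mp hodd).neg_one_pow, neg_one_mul] at hdet
  exact hN (self_eq_neg.mp hdet)
end

section
/- Let n ≥ 1 and let B be a nonempty collection of subsets of [n] forming the bases of an even Δ-matroid, i.e.: (i) for all μ, ν ∈ B, |μ Δ ν| is even, and (ii) for all μ, ν ∈ B and every i ∈ μ Δ ν there exists j ∈ μ Δ ν with j ≠ i such that μ Δ {i,j} ∈ B. Then for every u : [n] → ℝ, the set B_u = { λ ∈ B : Σ_{k∈λ} u(k) ≤ Σ_{k∈λ'} u(k) for all λ' ∈ B } is nonempty and again satisfies (i) and (ii); that is, the face of an even Δ-matroid polytope cut out by minimizing a linear functional is again the polytope of an even Δ-matroid. -/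
open Finset
open scoped symmDiff

/-- `B` is the collection of bases of an even Δ-matroid on `[n]`: all pairwise symmetric
differences of bases are even, and the symmetric exchange axiom holds. -/
def IsEvenDeltaMatroid {n : ℕ} (B : Set (Finset (Fin n))) : Prop :=
  (∀ μ ∈ B, ∀ ν ∈ B, Even ((μ ∆ ν).card)) ∧
  (∀ μ ∈ B, ∀ ν ∈ B, ∀ i ∈ μ ∆ ν, ∃ j ∈ μ ∆ ν, j ≠ i ∧ μ ∆ ({i, j} : Finset (Fin n)) ∈ B)

namespace IsEvenDeltaMatroid

variable {n : ℕ} {B : Set (Finset (Fin n))}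

/-- Strong symmetric exchange between bases at distance four. -/
theorem strong_exchange_of_four (hM : IsEvenDeltaMatroid B) {μ : Finset (Fin n)} {i a b c : Fin n}
    (hia : i ≠ a) (hib : i ≠ b) (hic : i ≠ c) (hab : a ≠ b) (hac : a ≠ c) (hbc : b ≠ c)
    (hμ : μ ∈ B) (hν : μ ∆ {i, a, b, c} ∈ B) :
    (μ ∆ {i, a} ∈ B ∧ μ ∆ {b, c} ∈ B) ∨ (μ ∆ {i, b} ∈ B ∧ μ ∆ {a, c} ∈ B) ∨
      (μ ∆ {i, c} ∈ B ∧ μ ∆ {a, b} ∈ B) := by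
  have star : ∀ x ∈ ({i, a, b, c} : Finset (Fin n)),
      ∃ y ∈ ({i, a, b, c} : Finset (Fin n)), y ≠ x ∧ μ ∆ {x, y} ∈ B := by
    intro x hx
    have h := hM.2 μ hμ _ hν x
    rw [symmDiff_symmDiff_cancel_left] at h
    exact h hx
  have costar : ∀ x ∈ ({i, a, b, c} : Finset (Fin n)),
      ∃ y ∈ ({i, a, b, c} : Finset (Fin n)), y ≠ x ∧ μ ∆ ({i, a, b, c} ∆ {x, y}) ∈ B := by
    intro x hx
    have h := hM.2 _ hν μ hμ x
    rw [symmDiff_comm (μ ∆ _) μ, symmDiff_symmDiff_cancel_left] at h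
    simpa only [symmDiff_assoc] using h hx
  have e₁ : ({i, a, b, c} : Finset (Fin n)) ∆ {i, a} = {b, c} := by
    ext z; simp only [mem_symmDiff, mem_insert, mem_singleton]; grind
  have e₂ : ({i, a, b, c} : Finset (Fin n)) ∆ {i, b} = {a, c} := by
    ext z; simp only [mem_symmDiff, mem_insert, mem_singleton]; grind
  have e₃ : ({i, a, b, c} : Finset (Fin n)) ∆ {i, c} = {a, b} := by
    ext z; simp only [mem_symmDiff, mem_insert, mem_singleton]; grind
  have e₄ : ({i, a, b, c} : Finset (Fin n)) ∆ {b, c} = {i, a} := by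
    ext z; simp only [mem_symmDiff, mem_insert, mem_singleton]; grind
  have e₅ : ({i, a, b, c} : Finset (Fin n)) ∆ {a, c} = {i, b} := by
    ext z; simp only [mem_symmDiff, mem_insert, mem_singleton]; grind
  have e₆ : ({i, a, b, c} : Finset (Fin n)) ∆ {a, b} = {i, c} := by
    ext z; simp only [mem_symmDiff, mem_insert, mem_singleton]; grind
  simp only [mem_insert, mem_singleton, forall_eq_or_imp, forall_eq, exists_eq_or_imp,
    exists_eq_left, ne_eq, not_true_eq_false, false_and, false_or, or_false,
    pair_comm a i, pair_comm b i, pair_comm c i, pair_comm b a, pair_comm c a, pair_comm c b,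
    hia, hib, hic, hab, hac, hbc, hia.symm, hib.symm, hic.symm, hab.symm, hac.symm, hbc.symm,
    not_false_eq_true, true_and, e₁, e₂, e₃, e₄, e₅, e₆] at star costar
  clear hμ hν e₁ e₂ e₃ e₄ e₅ e₆
  grind only

/-- Strong symmetric exchange: one pair can be exchanged in both bases simultaneously. -/
theorem strong_exchange (hM : IsEvenDeltaMatroid B) {μ ν : Finset (Fin n)}
    (hμ : μ ∈ B) (hν : ν ∈ B) {i : Fin n} (hi : i ∈ μ ∆ ν) :
    ∃ j ∈ μ ∆ ν, j ≠ i ∧ μ ∆ {i, j} ∈ B ∧ ν ∆ {i, j} ∈ B := by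
  induction hd : (μ ∆ ν).card using Nat.strong_induction_on generalizing μ with
  | _ d ih =>
  subst hd
  by_contra! hno
  -- An exchange pair of `μ` avoiding `i` extends to a basis `μ ∆ {x, h, i, j}`.
  have extend : ∀ x ∈ μ ∆ ν, ∀ h ∈ μ ∆ ν, x ≠ h → x ≠ i → h ≠ i → μ ∆ {h, x} ∈ B →
      ∃ j ∈ μ ∆ ν, j ≠ i ∧ j ≠ x ∧ j ≠ h ∧ ν ∆ {i, j} ∈ B ∧
        ((μ ∆ {i, h} ∈ B) ∨ (μ ∆ {i, x} ∈ B ∧ μ ∆ {h, j} ∈ B)) := by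
    intro x hx h hh hxh hxi hhi hB
    have hD : (μ ∆ {h, x}) ∆ ν = (μ ∆ ν) \ {h, x} := by
      ext z
      simp only [mem_symmDiff, mem_sdiff, mem_insert, mem_singleton] at hx hh ⊢
      grind
    have hlt : ((μ ∆ {h, x}) ∆ ν).card < (μ ∆ ν).card := by
      rw [hD]
      exact card_lt_card (sdiff_ssubset (by grind) (by simp))
    obtain ⟨j, hj, hji, hj₁, hj₂⟩ := ih _ hlt hB (by rw [hD]; simp [hi, hxi.symm, hhi.symm]) rfl
    rw [hD] at hj
    simp only [mem_sdiff, mem_insert, mem_singleton, not_or] at hj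
    obtain ⟨hjD, hjh, hjx⟩ := hj
    refine ⟨j, hjD, hji, hjx, hjh, hj₂, ?_⟩
    have h4 : (μ ∆ {h, x}) ∆ {i, j} = μ ∆ {i, h, x, j} := by
      rw [symmDiff_assoc]
      congr 1
      ext z
      simp only [mem_symmDiff, mem_insert, mem_singleton]
      grind
    rw [h4] at hj₁
    rcases hM.strong_exchange_of_four hhi.symm hxi.symm hji.symm hxh.symm (Ne.symm hjh)
      (Ne.symm hjx) hμ hj₁ with h' | h' | h'
    · exact .inl h'.1
    · exact .inr h'
    · exact absurd hj₂ (hno j hjD hji h'.1)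
  obtain ⟨h, hh, hhi, hνh⟩ := hM.2 ν hν μ hμ i (by rwa [symmDiff_comm])
  rw [symmDiff_comm] at hh
  have hμh : μ ∆ {i, h} ∉ B := fun hc => hno h hh hhi hc hνh
  obtain ⟨x, hx, hxh, hμx⟩ := hM.2 μ hμ ν hν h hh
  have hxi : x ≠ i := by
    rintro rfl
    exact hμh (by rwa [pair_comm])
  obtain ⟨j, hj, hji, -, hjh, hνj, hc | ⟨-, hμj⟩⟩ := extend x hx h hh hxh hxi hhi hμx
  · exact hμh hc
  obtain ⟨-, -, -, -, -, -, hc | ⟨hc, -⟩⟩ := extend j hj h hh hjh hji hhi hμj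
  · exact hμh hc
  · exact hno j hj hji hc hνj

end IsEvenDeltaMatroid

/-- Exchanging elements of `s ∆ t` in both `s` and `t` preserves the total weight. -/
theorem sum_symmDiff_add_sum_symmDiff {α M : Type*} [DecidableEq α] [AddCommMonoid M]
    (u : α → M) {s t p : Finset α} (hp : p ⊆ s ∆ t) :
    ∑ k ∈ s ∆ p, u k + ∑ k ∈ t ∆ p, u k = ∑ k ∈ s, u k + ∑ k ∈ t, u k := by
  have hU : (s ∆ p) ∪ (t ∆ p) = s ∪ t := by
    ext z
    have := @hp z
    simp only [mem_union, mem_symmDiff] at this ⊢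
    tauto
  have hI : (s ∆ p) ∩ (t ∆ p) = s ∩ t := by
    ext z
    have := @hp z
    simp only [mem_inter, mem_symmDiff] at this ⊢
    tauto
  rw [← sum_union_inter, hU, hI, sum_union_inter]

theorem face_of_even_deltaMatroid_is_even_deltaMatroid {n : ℕ} (hn : 1 ≤ n)
    (B : Set (Finset (Fin n))) (hB : B.Nonempty) (hM : IsEvenDeltaMatroid B)
    (u : Fin n → ℝ) :
    (minimizers B u).Nonempty ∧ IsEvenDeltaMatroid (minimizers B u) := by
  refine ⟨?_, fun μ hμ ν hν => hM.1 μ hμ.1 ν hν.1, fun μ hμ ν hν i hi => ?_⟩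
  · obtain ⟨l, hl, hmin⟩ := Set.exists_min_image B (fun l => ∑ k ∈ l, u k) B.toFinite hB
    exact ⟨l, hl, hmin⟩
  · obtain ⟨j, hj, hji, hμj, hνj⟩ := hM.strong_exchange hμ.1 hν.1 hi
    refine ⟨j, hj, hji, hμj, fun l hl => ?_⟩
    have hsum := sum_symmDiff_add_sum_symmDiff u (insert_subset hi (singleton_subset_iff.2 hj))
    linarith [hμ.2 l hl, hν.2 _ hνj]
end
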